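/- Let (Q_1, ..., Q_n), with n ≥ 1, be a decomposition of a query graph Q and let (G_1, ..., G_m), with m ≥ 1, be a decomposition of a data graph G. Then e is a total embedding of Q in G if and only if for every j with 1 ≤ j ≤ n there exist indices 1 ≤ i_{j,1} < ... < i_{j,k_j} ≤ m and useful partial embeddings e_{j,1}, ..., e_{j,k_j} of Q_j in G_{i_{j,1}}, ..., G_{i_{j,k_j}} satisfying: (a) for every j and every triple (v, p, u) ∈ Q_j there exists some ℓ such that e_{j,ℓ}(v) and e_{j,ℓ}(u) are defined and (e_{j,ℓ}(v), p, e_{j,ℓ}(u)) ∈ G_{i_{j,ℓ}}; (b) all the partial embeddings e_{j,ℓ} (over all j and ℓ) are pairwise compatible; and (c) the join of all the e_{j,ℓ} equals e. -/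

import Mathlib

namespace RDF

variable {α β : Type*}

/-- The nodes (subjects and objects) of a set of triples. -/
def Nodes (F : Set (α × β × α)) : Set α :=
  {v | (∃ p o, (v, p, o) ∈ F) ∨ (∃ s p, (s, p, v) ∈ F)}

/-- The background setting: `Uso` (URI references used as subjects/objects), `L` (literals)
and `V` (variables) are countably infinite and pairwise disjoint subsets of `α`;
the predicate URIs form the (separate) type `β`. -/
def Setting (Uso L V : Set α) : Prop :=
  Uso.Countable ∧ Uso.Infinite ∧ L.Countable ∧ L.Infinite ∧ V.Countable ∧ V.Infinite ∧
    Disjoint Uso L ∧ Disjoint Uso V ∧ Disjoint L V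

/-- `G` is a data graph: a nonempty set of data triples. -/
def IsDataGraph (Uso L : Set α) (G : Set (α × β × α)) : Prop :=
  G.Nonempty ∧ ∀ t ∈ G, t.1 ∈ Uso ∧ t.2.2 ∈ Uso ∪ L

/-- `Q` is a query graph: a nonempty set of query triples. -/
def IsQueryGraph (Uso L V : Set α) (Q : Set (α × β × α)) : Prop :=
  Q.Nonempty ∧ ∀ t ∈ Q, t.1 ∈ Uso ∪ V ∧ t.2.2 ∈ Uso ∪ L ∪ V

/-- Partial mappings are modeled as functions `α → Option α`.  A total embedding of `Q`
in `G` is defined exactly on the nodes of `Q`, takes values in the nodes of `G`,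
is the identity on non-variables, and maps every triple of `Q` to a triple of `G`. -/
def IsTotalEmbedding (V : Set α) (Q G : Set (α × β × α)) (e : α → Option α) : Prop :=
  (∀ v, (e v).isSome ↔ v ∈ Nodes Q) ∧
    (∀ v a, e v = some a → a ∈ Nodes G) ∧
    (∀ v ∈ Nodes Q, v ∉ V → e v = some v) ∧
    (∀ s p o, (s, p, o) ∈ Q → ∃ s' o', e s = some s' ∧ e o = some o' ∧ (s', p, o') ∈ G)

/-- A partial embedding of `Q` in `G`. -/
def IsPartialEmbedding (V : Set α) (Q G : Set (α × β × α)) (e : α → Option α) : Prop :=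
  (∀ v, (e v).isSome → v ∈ Nodes Q) ∧
    (∀ v a, e v = some a → a ∈ Nodes G) ∧
    (∀ v a, e v = some a → v ∉ V → a = v) ∧
    (∀ v a, e v = some a → v ∈ V →
      ∃ u u' p, e u = some u' ∧
        (((v, p, u) ∈ Q ∧ (a, p, u') ∈ G) ∨ ((u, p, v) ∈ Q ∧ (u', p, a) ∈ G)))

/-- A partial embedding is non-trivial if it maps at least one triple of `Q` into `G`. -/
def NonTrivial (Q G : Set (α × β × α)) (e : α → Option α) : Prop :=
  ∃ v₁ p v₂ a b, (v₁, p, v₂) ∈ Q ∧ e v₁ = some a ∧ e v₂ = some b ∧ (a, p, b) ∈ G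

/-- Two partial mappings are compatible if they agree wherever both are defined. -/
def Compatible (e₁ e₂ : α → Option α) : Prop :=
  ∀ v a b, e₁ v = some a → e₂ v = some b → a = b

/-- The join of two partial mappings (the first takes precedence where defined). -/
def join (e₁ e₂ : α → Option α) : α → Option α :=
  fun v => (e₁ v).elim (e₂ v) some

/-- `e` is the join of the mutually compatible family `f` of partial mappings:
`e` is defined at `v` with value `a` iff some member of the family is. -/
def IsJoin {ι : Type*} (f : ι → α → Option α) (e : α → Option α) : Prop :=
  ∀ v a, e v = some a ↔ ∃ i, f i v = some a

/-- `seg` is a decomposition of the graph `F` into (nonempty) segments. -/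
def IsDecomposition {m : ℕ} (F : Set (α × β × α)) (seg : Fin m → Set (α × β × α)) : Prop :=
  (∀ i, (seg i).Nonempty) ∧ (∀ i, seg i ⊆ F) ∧ (⋃ i, seg i) = F

/-- A decomposition is non-redundant if its segments are pairwise disjoint. -/
def NonRedundant {m : ℕ} (seg : Fin m → Set (α × β × α)) : Prop :=
  ∀ i j, i ≠ j → seg i ∩ seg j = ∅

/-- Border nodes of two segments. -/
def BorderPair (L : Set α) (F₁ F₂ : Set (α × β × α)) : Set α :=
  (Nodes F₁ ∩ Nodes F₂) \ L

/-- Border nodes of segment `i` of a decomposition. -/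
def Border {m : ℕ} (L : Set α) (seg : Fin m → Set (α × β × α)) (i : Fin m) : Set α :=
  ⋃ j ∈ {j : Fin m | j ≠ i}, BorderPair L (seg i) (seg j)

/-- Useful partial embedding of `Q` in the segment `seg i` of a decomposition. -/
def IsUseful {m : ℕ} (V L : Set α) (Q : Set (α × β × α))
    (seg : Fin m → Set (α × β × α)) (i : Fin m) (e : α → Option α) : Prop :=
  IsPartialEmbedding V Q (seg i) e ∧
    NonTrivial Q (seg i) e ∧
    (∀ v ∈ Nodes Q ∩ Nodes (seg i), (e v).isSome) ∧
    (∀ v p u a, (v, p, u) ∈ Q → e v = some a → a ∉ Border L seg i ∪ L →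
      ∃ b, e u = some b ∧ (a, p, b) ∈ seg i) ∧
    (∀ v p u b, (v, p, u) ∈ Q → e u = some b → b ∉ Border L seg i ∪ L →
      ∃ a, e v = some a ∧ (a, p, b) ∈ seg i)

/-- Generalized star query with central node `c`. -/
def IsGenStar (Q : Set (α × β × α)) (c : α) : Prop :=
  c ∈ Nodes Q ∧ ∀ t ∈ Q, t.1 = c ∨ t.2.2 = c

/-- Subject-object star query (so-query) with central node `c`. -/
def IsSOStar (Q : Set (α × β × α)) (c : α) : Prop :=
  IsGenStar Q c ∧ ∃ t ∈ Q, t.1 = c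

/-- `W` is a node cover of `Q`. -/
def IsNodeCover (L : Set α) (Q : Set (α × β × α)) (W : Set α) : Prop :=
  W ⊆ Nodes Q \ L ∧ ∀ t ∈ Q, t.1 ∈ W ∨ t.2.2 ∈ W

/-- `N` is a partition (into nonempty blocks) of the non-literal nodes of `G`. -/
def IsPartitionOfNodes {m : ℕ} (L : Set α) (G : Set (α × β × α)) (N : Fin m → Set α) : Prop :=
  (∀ i, (N i).Nonempty) ∧ (⋃ i, N i) = Nodes G \ L ∧ ∀ i j, i ≠ j → N i ∩ N j = ∅

/-- The `i`-th segment of the s-decomposition of `G` determined by the node partition `N`. -/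
def sSeg {m : ℕ} (G : Set (α × β × α)) (N : Fin m → Set α) (i : Fin m) : Set (α × β × α) :=
  {t | t ∈ G ∧ (t.1 ∈ N i ∨ t.2.2 ∈ N i)}

/-- Replicated node of the `i`-th s-segment. -/
def ReplicatedNode {m : ℕ} (L : Set α) (G : Set (α × β × α)) (N : Fin m → Set α)
    (i : Fin m) (v : α) : Prop :=
  v ∈ Nodes (sSeg G N i) ∧ v ∉ L ∧ v ∉ N i

/-- Replicated triple of the `i`-th s-segment. -/
def ReplicatedTriple {m : ℕ} (L : Set α) (G : Set (α × β × α)) (N : Fin m → Set α)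
    (i : Fin m) (t : α × β × α) : Prop :=
  t ∈ sSeg G N i ∧ (ReplicatedNode L G N i t.1 ∨ ReplicatedNode L G N i t.2.2)

open Classical in
/-- Restriction of a partial mapping to a set. -/
noncomputable def restrictTo (S : Set α) (e : α → Option α) : α → Option α :=
  fun v => if v ∈ S then e v else none

/-- The answer determined by an embedding: its restriction to the variables. -/
noncomputable def answerOf (V : Set α) (e : α → Option α) : α → Option α :=
  restrictTo V e

/-- The set of answers of `Q` over `G`. -/
def Answers (V : Set α) (Q G : Set (α × β × α)) : Set (α → Option α) :=
  {a | ∃ e, IsTotalEmbedding V Q G e ∧ a = answerOf V e}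

/-- The nodes of a data graph are not variables. -/
theorem notMem_variables_of_mem_nodes {Uso L V : Set α} (hset : Setting Uso L V)
    {G : Set (α × β × α)} (hG : IsDataGraph Uso L G) {v : α} (hv : v ∈ Nodes G) : v ∉ V := by
  obtain ⟨-, -, -, -, -, -, -, hUV, hLV⟩ := hset
  intro hvV
  rcases hv with ⟨p, o, h⟩ | ⟨s, p, h⟩
  · exact Set.disjoint_left.1 hUV (hG.2 _ h).1 hvV
  · rcases (hG.2 _ h).2 with h | h
    · exact Set.disjoint_left.1 hUV h hvV
    · exact Set.disjoint_left.1 hLV h hvV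

theorem Nodes.mono {F F' : Set (α × β × α)} (h : F ⊆ F') : Nodes F ⊆ Nodes F' := by
  rintro v (⟨p, o, hv⟩ | ⟨s, p, hv⟩)
  · exact Or.inl ⟨p, o, h hv⟩
  · exact Or.inr ⟨s, p, h hv⟩

theorem IsDecomposition.exists_mem {m : ℕ} {F : Set (α × β × α)}
    {seg : Fin m → Set (α × β × α)} (h : IsDecomposition F seg) {t : α × β × α} (ht : t ∈ F) :
    ∃ i, t ∈ seg i := by
  rw [← h.2.2] at ht
  exact Set.mem_iUnion.1 ht

theorem eq_of_mem_nodes_of_notMem_border {m : ℕ} {L : Set α} {seg : Fin m → Set (α × β × α)}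
    {i k : Fin m} {a : α} (hi : a ∈ Nodes (seg i)) (hk : a ∈ Nodes (seg k))
    (ha : a ∉ Border L seg i ∪ L) : k = i := by
  by_contra hne
  exact ha (Or.inl (Set.mem_biUnion (x := k) hne ⟨⟨hi, hk⟩, fun hL => ha (Or.inr hL)⟩))

/-- The triples of `Q` that `e` maps into `F`. -/
def mappedTriples (Q F : Set (α × β × α)) (e : α → Option α) : Set (α × β × α) :=
  {t | t ∈ Q ∧ ∃ a b, e t.1 = some a ∧ e t.2.2 = some b ∧ (a, t.2.1, b) ∈ F}

/-- The restriction of `e` to the endpoints of the triples of `Q` mapped into `F` and to the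
nodes common to `Q` and `F`. -/
noncomputable def localPart (Q F : Set (α × β × α)) (e : α → Option α) : α → Option α :=
  restrictTo (Nodes (mappedTriples Q F e) ∪ Nodes Q ∩ Nodes F) e

theorem restrictTo_eq_some {S : Set α} {e : α → Option α} {v a : α} :
    restrictTo S e v = some a ↔ v ∈ S ∧ e v = some a := by
  unfold restrictTo
  split_ifs with h <;> simp [h]

theorem localPart_of_mem_mappedTriples {Q F : Set (α × β × α)} {e : α → Option α} {v u : α} {p : β}
    {a b : α} (hQ : (v, p, u) ∈ Q) (hv : e v = some a) (hu : e u = some b) (hF : (a, p, b) ∈ F) :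
    localPart Q F e v = some a ∧ localPart Q F e u = some b := by
  have ht : (v, p, u) ∈ mappedTriples Q F e := ⟨hQ, a, b, hv, hu, hF⟩
  exact ⟨restrictTo_eq_some.2 ⟨Or.inl (Or.inl ⟨p, u, ht⟩), hv⟩,
    restrictTo_eq_some.2 ⟨Or.inl (Or.inr ⟨v, p, ht⟩), hu⟩⟩

/-- The part of a total embedding that lives in a segment is a useful partial embedding of a
subquery, provided it maps some triple of the subquery into that segment. -/
theorem IsTotalEmbedding.isUseful_localPart {Uso L V : Set α} (hset : Setting Uso L V)
    {Q R G : Set (α × β × α)} (hR : R ⊆ Q) (hG : IsDataGraph Uso L G)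
    {m : ℕ} {seg : Fin m → Set (α × β × α)} (hseg : IsDecomposition G seg)
    {e : α → Option α} (he : IsTotalEmbedding V Q G e) {i : Fin m}
    (hi : (mappedTriples R (seg i) e).Nonempty) :
    IsUseful V L R seg i (localPart R (seg i) e) := by
  obtain ⟨-, -, hconst, htrip⟩ := he
  have hfix : ∀ v ∈ Nodes R ∩ Nodes (seg i), v ∉ V ∧ e v = some v := fun v hv => by
    have hvV := notMem_variables_of_mem_nodes hset hG (Nodes.mono (hseg.2.1 i) hv.2)
    exact ⟨hvV, hconst v (Nodes.mono hR hv.1) hvV⟩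
  have hnode : ∀ v a, localPart R (seg i) e v = some a → v ∈ Nodes R ∧ a ∈ Nodes (seg i) := by
    intro v a h
    obtain ⟨(⟨p, u, hQ, b, c, hb, hc, hF⟩ | ⟨u, p, hQ, b, c, hb, hc, hF⟩) | hv, ha⟩ :=
      restrictTo_eq_some.1 h
    · obtain rfl : b = a := Option.some.inj (hb.symm.trans ha)
      exact ⟨Or.inl ⟨p, u, hQ⟩, Or.inl ⟨p, c, hF⟩⟩
    · obtain rfl : c = a := Option.some.inj (hc.symm.trans ha)
      exact ⟨Or.inr ⟨u, p, hQ⟩, Or.inr ⟨b, p, hF⟩⟩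
    · obtain rfl : v = a := Option.some.inj ((hfix v hv).2.symm.trans ha)
      exact hv
  refine ⟨⟨?_, fun v a h => (hnode v a h).2, ?_, ?_⟩, ?_, ?_, ?_, ?_⟩
  · intro v hv
    obtain ⟨a, ha⟩ := Option.isSome_iff_exists.1 hv
    exact (hnode v a ha).1
  · intro v a h hv
    exact Option.some.inj ((restrictTo_eq_some.1 h).2.symm.trans
      (hconst v (Nodes.mono hR (hnode v a h).1) hv))
  · intro v a h hvV
    obtain ⟨(⟨p, u, hQ, b, c, hb, hc, hF⟩ | ⟨u, p, hQ, b, c, hb, hc, hF⟩) | hv, ha⟩ :=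
      restrictTo_eq_some.1 h
    · obtain rfl : b = a := Option.some.inj (hb.symm.trans ha)
      exact ⟨u, c, p, (localPart_of_mem_mappedTriples hQ hb hc hF).2, Or.inl ⟨hQ, hF⟩⟩
    · obtain rfl : c = a := Option.some.inj (hc.symm.trans ha)
      exact ⟨u, b, p, (localPart_of_mem_mappedTriples hQ hb hc hF).1, Or.inr ⟨hQ, hF⟩⟩
    · exact absurd hvV (hfix v hv).1
  · obtain ⟨⟨v, p, u⟩, hQ, a, b, ha, hb, hF⟩ := hi
    have h := localPart_of_mem_mappedTriples hQ ha hb hF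
    exact ⟨v, p, u, a, b, hQ, h.1, h.2, hF⟩
  · intro v hv
    exact Option.isSome_iff_exists.2 ⟨v, restrictTo_eq_some.2 ⟨Or.inr hv, (hfix v hv).2⟩⟩
  · intro v p u a hQ h hborder
    obtain ⟨a', b, ha, hb, hab⟩ := htrip v p u (hR hQ)
    obtain rfl : a' = a := Option.some.inj (ha.symm.trans (restrictTo_eq_some.1 h).2)
    obtain ⟨k, hk⟩ := hseg.exists_mem hab
    obtain rfl := eq_of_mem_nodes_of_notMem_border (hnode v a' h).2 (Or.inl ⟨p, b, hk⟩) hborder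
    exact ⟨b, (localPart_of_mem_mappedTriples hQ ha hb hk).2, hk⟩
  · intro v p u b hQ h hborder
    obtain ⟨a, b', ha, hb, hab⟩ := htrip v p u (hR hQ)
    obtain rfl : b' = b := Option.some.inj (hb.symm.trans (restrictTo_eq_some.1 h).2)
    obtain ⟨k, hk⟩ := hseg.exists_mem hab
    obtain rfl := eq_of_mem_nodes_of_notMem_border (hnode u b' h).2 (Or.inr ⟨a, p, hk⟩) hborder
    exact ⟨a, (localPart_of_mem_mappedTriples hQ ha hb hk).1, hk⟩

/-- Theorem: total embeddings vs. useful partial embeddings of the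
subqueries over the data graph segments. -/
theorem statement2 {α β : Type*} [Countable β] [Infinite β]
    {Uso L V : Set α} (hset : Setting Uso L V)
    {Q : Set (α × β × α)} (hQ : IsQueryGraph Uso L V Q)
    {n : ℕ} (hn : 1 ≤ n)
    {Qs : Fin n → Set (α × β × α)} (hQs : IsDecomposition Q Qs)
    {G : Set (α × β × α)} (hG : IsDataGraph Uso L G)
    {m : ℕ} (hm : 1 ≤ m)
    {seg : Fin m → Set (α × β × α)} (hseg : IsDecomposition G seg)
    (e : α → Option α) :
    IsTotalEmbedding V Q G e ↔
      ∃ (k : Fin n → ℕ) (idx : ∀ j, Fin (k j) → Fin m)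
        (f : ∀ j, Fin (k j) → α → Option α),
        (∀ j, StrictMono (idx j)) ∧
        (∀ j ℓ, IsUseful V L (Qs j) seg (idx j ℓ) (f j ℓ)) ∧
        (∀ j v p u, (v, p, u) ∈ Qs j →
          ∃ ℓ a b, f j ℓ v = some a ∧ f j ℓ u = some b ∧ (a, p, b) ∈ seg (idx j ℓ)) ∧
        (∀ j₁ ℓ₁ j₂ ℓ₂, Compatible (f j₁ ℓ₁) (f j₂ ℓ₂)) ∧
        IsJoin (fun x : (j : Fin n) × Fin (k j) => f x.1 x.2) e := by
  classical
  constructor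
  · intro he
    let S : Fin n → Finset (Fin m) := fun j =>
      Finset.univ.filter fun i => (mappedTriples (Qs j) (seg i) e).Nonempty
    have hcover : ∀ j v p u, (v, p, u) ∈ Qs j → ∃ (ℓ : Fin (S j).card) (a b : α),
        localPart (Qs j) (seg ((S j).orderEmbOfFin rfl ℓ)) e v = some a ∧
        localPart (Qs j) (seg ((S j).orderEmbOfFin rfl ℓ)) e u = some b ∧
        (a, p, b) ∈ seg ((S j).orderEmbOfFin rfl ℓ) := by
      intro j v p u h
      obtain ⟨a, b, ha, hb, hab⟩ := he.2.2.2 v p u (hQs.2.1 j h)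
      obtain ⟨i, hi⟩ := hseg.exists_mem hab
      have hiS : i ∈ Set.range ((S j).orderEmbOfFin rfl) := by
        rw [Finset.range_orderEmbOfFin]
        exact Finset.mem_coe.2 (Finset.mem_filter.2
          ⟨Finset.mem_univ i, (v, p, u), h, a, b, ha, hb, hi⟩)
      obtain ⟨ℓ, rfl⟩ := hiS
      have := localPart_of_mem_mappedTriples h ha hb hi
      exact ⟨ℓ, a, b, this.1, this.2, hi⟩
    refine ⟨fun j => (S j).card, fun j => (S j).orderEmbOfFin rfl,
      fun j ℓ => localPart (Qs j) (seg ((S j).orderEmbOfFin rfl ℓ)) e,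
      fun j => ((S j).orderEmbOfFin rfl).strictMono, ?_, hcover, ?_, ?_⟩
    · intro j ℓ
      exact he.isUseful_localPart hset (hQs.2.1 j) hG hseg
        (Finset.mem_filter.1 ((S j).orderEmbOfFin_mem rfl ℓ)).2
    · intro j₁ ℓ₁ j₂ ℓ₂ v a b ha hb
      exact Option.some.inj ((restrictTo_eq_some.1 ha).2.symm.trans (restrictTo_eq_some.1 hb).2)
    · intro v a
      refine ⟨fun hv => ?_, fun ⟨_, h⟩ => (restrictTo_eq_some.1 h).2⟩
      rcases (he.1 v).1 (Option.isSome_iff_exists.2 ⟨a, hv⟩) with ⟨p, u, h⟩ | ⟨u, p, h⟩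
      · obtain ⟨j, hj⟩ := hQs.exists_mem h
        obtain ⟨ℓ, b, c, hb, -, -⟩ := hcover j v p u hj
        have hba := (restrictTo_eq_some.1 hb).2.symm.trans hv
        exact ⟨⟨j, ℓ⟩, hb.trans hba⟩
      · obtain ⟨j, hj⟩ := hQs.exists_mem h
        obtain ⟨ℓ, b, c, -, hc, -⟩ := hcover j u p v hj
        have hca := (restrictTo_eq_some.1 hc).2.symm.trans hv
        exact ⟨⟨j, ℓ⟩, hc.trans hca⟩
  · rintro ⟨k, idx, f, -, huseful, hcover, -, hjoin⟩
    have htrip : ∀ s p o, (s, p, o) ∈ Q →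
        ∃ s' o', e s = some s' ∧ e o = some o' ∧ (s', p, o') ∈ G := by
      intro s p o h
      obtain ⟨j, hj⟩ := hQs.exists_mem h
      obtain ⟨ℓ, a, b, ha, hb, hab⟩ := hcover j s p o hj
      exact ⟨a, b, (hjoin s a).2 ⟨⟨j, ℓ⟩, ha⟩, (hjoin o b).2 ⟨⟨j, ℓ⟩, hb⟩, hseg.2.1 _ hab⟩
    have hdom : ∀ v ∈ Nodes Q, ∃ a, e v = some a := by
      rintro v (⟨p, u, h⟩ | ⟨u, p, h⟩)
      · obtain ⟨a, -, ha, -⟩ := htrip v p u h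
        exact ⟨a, ha⟩
      · obtain ⟨-, a, -, ha, -⟩ := htrip u p v h
        exact ⟨a, ha⟩
    refine ⟨fun v => ⟨fun hv => ?_, fun hv => Option.isSome_iff_exists.2 (hdom v hv)⟩,
      ?_, ?_, htrip⟩
    · obtain ⟨a, ha⟩ := Option.isSome_iff_exists.1 hv
      obtain ⟨⟨j, ℓ⟩, h⟩ := (hjoin v a).1 ha
      exact Nodes.mono (hQs.2.1 j)
        ((huseful j ℓ).1.1 v (Option.isSome_iff_exists.2 ⟨a, h⟩))
    · intro v a ha
      obtain ⟨⟨j, ℓ⟩, h⟩ := (hjoin v a).1 ha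
      exact Nodes.mono (hseg.2.1 _) ((huseful j ℓ).1.2.1 v a h)
    · intro v hv hvV
      obtain ⟨a, ha⟩ := hdom v hv
      obtain ⟨⟨j, ℓ⟩, h⟩ := (hjoin v a).1 ha
      rw [ha, (huseful j ℓ).1.2.2.1 v a h hvV]

end RDF
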